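/- Fix n ≥ 1 and let Q be the Boolean conjunctive query with negation H() ← Dom(w₀,w₀), Dom(w₁,w₁), Dom(x₁,x₁), …, Dom(xₙ,xₙ), ¬Dom(w₀,w₁), ¬R(x₁,…,xₙ), over the schema with binary relation Dom and n-ary relation R. Let ρ be the distribution policy with universe U = {0,1} over the network {κ₁, κ₂} where κ₁ is responsible for all facts over this schema with values in {0,1} except R(0,…,0), and κ₂ is responsible only for R(0,…,0). Let I = {Dom(0,0), Dom(1,1)} ∪ {R(a₁,…,aₙ) | (a₁,…,aₙ) ∈ {0,1}ⁿ}. Then (i) Q is not parallel-sound on I under ρ, and (ii) every instance I* of facts with values in {0,1} on which Q is not parallel-sound under ρ satisfies I ⊆ I*; in particular the smallest counterexample to parallel-soundness has 2ⁿ + 2 facts. -/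

import Mathlib

/-- An atom `R(x₁,…,x_k)`: a relation name together with a tuple of variables. -/
structure Atom (R V : Type) where
  rel : R
  args : List V
deriving DecidableEq

/-- A fact `R(t)`: a relation name together with a tuple of data values. -/
structure DBFact (R D : Type) where
  rel : R
  args : List D
deriving DecidableEq

/-- Applying a valuation to an atom yields a fact. -/
def Atom.app {R V D : Type} (f : V → D) (a : Atom R V) : DBFact R D :=
  ⟨a.rel, a.args.map f⟩

/-- The variables occurring in an atom. -/
def Atom.vars {R V : Type} (a : Atom R V) : Set V := {v | v ∈ a.args}

/-- A conjunctive query with negation and inequalities (CQ¬,≠): a head atom,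
finite sets of positive and negated body atoms, and a finite set of
inequalities between variables. -/
structure CQ (R V : Type) where
  head : Atom R V
  pos : Finset (Atom R V)
  neg : Finset (Atom R V)
  ineq : Finset (V × V)

namespace CQ

variable {R V D : Type}

/-- The variables occurring in a query. -/
def vars (Q : CQ R V) : Set V :=
  Q.head.vars ∪ (⋃ a ∈ (↑Q.pos : Set (Atom R V)), a.vars) ∪
    (⋃ a ∈ (↑Q.neg : Set (Atom R V)), a.vars) ∪
    (⋃ p ∈ (↑Q.ineq : Set (V × V)), {p.1, p.2})

/-- Safety: every head variable and every variable of a negated atom occurs in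
some positive atom. -/
def safe (Q : CQ R V) : Prop :=
  (∀ v ∈ Q.head.vars, ∃ a ∈ Q.pos, v ∈ a.args) ∧
  (∀ a ∈ Q.neg, ∀ v ∈ a.args, ∃ b ∈ Q.pos, v ∈ b.args)

/-- A query is full if every one of its variables occurs in its head atom. -/
def isFull (Q : CQ R V) : Prop := ∀ v ∈ Q.vars, v ∈ Q.head.args

/-- The facts required by a valuation `f`: `f(pos(Q))`. -/
def posFacts (Q : CQ R V) (f : V → D) : Set (DBFact R D) :=
  Atom.app f '' (↑Q.pos : Set (Atom R V))

/-- The facts prohibited by a valuation `f`: `f(neg(Q))`. -/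
def negFacts (Q : CQ R V) (f : V → D) : Set (DBFact R D) :=
  Atom.app f '' (↑Q.neg : Set (Atom R V))

/-- `f` is a valuation for `Q`: required and prohibited facts are disjoint and
all inequalities are respected. -/
def isVal (Q : CQ R V) (f : V → D) : Prop :=
  Q.posFacts f ∩ Q.negFacts f = ∅ ∧
  ∀ p ∈ Q.ineq, f p.1 ≠ f p.2

/-- `f` satisfies `Q` on `I`: all required facts are in `I` and no prohibited
fact is in `I`. -/
def sat (Q : CQ R V) (f : V → D) (I : Set (DBFact R D)) : Prop :=
  Q.posFacts f ⊆ I ∧ Q.negFacts f ∩ I = ∅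

/-- `Q(I)`: the set of facts derived on `I` by valuations satisfying `Q`. -/
def eval (Q : CQ R V) (I : Set (DBFact R D)) : Set (DBFact R D) :=
  {fc | ∃ f : V → D, Q.isVal f ∧ Q.sat f I ∧ Atom.app f Q.head = fc}

end CQ

/-- A union of conjunctive queries (with negation and inequalities): a finite,
nonempty family of CQ¬,≠s. -/
structure UCQ (R V : Type) where
  n : ℕ
  npos : 0 < n
  disj : Fin n → CQ R V

namespace UCQ

variable {R V D : Type}

/-- Well-formedness of a UCQ: every disjunct is safe, all disjuncts have the
same head relation, and distinct disjuncts have disjoint variable sets. -/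
def wf (Q : UCQ R V) : Prop :=
  (∀ i, (Q.disj i).safe) ∧
  (∀ i j, (Q.disj i).head.rel = (Q.disj j).head.rel) ∧
  (∀ i j, i ≠ j → Disjoint (Q.disj i).vars (Q.disj j).vars)

/-- `Q(I) = ⋃ᵢ Qᵢ(I)`. -/
def eval (Q : UCQ R V) (I : Set (DBFact R D)) : Set (DBFact R D) :=
  ⋃ i, (Q.disj i).eval I

/-- The maximum number of variables of any disjunct. -/
noncomputable def varmax (Q : UCQ R V) : ℕ :=
  Finset.univ.sup fun i => ((Q.disj i).vars).ncard

end UCQ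

/-- The values of the fact all belong to `U`. -/
def DBFact.valsIn {R D : Type} (fc : DBFact R D) (U : Set D) : Prop :=
  ∀ d ∈ fc.args, d ∈ U

/-- The active domain of an instance: all data values occurring in it. -/
def adom {R D : Type} (I : Set (DBFact R D)) : Set D :=
  {d | ∃ fc ∈ I, d ∈ fc.args}

/-- A distribution policy over network (node type) `K`: a universe `U` of data
values and, for each node, the set of facts (with values from `U`) it is
responsible for. -/
structure Policy (R D K : Type) where
  U : Set D
  rfacts : K → Set (DBFact R D)
  rfacts_vals : ∀ κ, ∀ fc ∈ rfacts κ, fc.valsIn U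

namespace Policy
variable {R D K : Type}
/-- The local instance at node `κ`. -/
def dist (ρ : Policy R D K) (I : Set (DBFact R D)) (κ : K) : Set (DBFact R D) :=
  I ∩ ρ.rfacts κ
end Policy

/-- `I` is an instance (finite set of facts) with values from `U`. -/
def instOver {R D : Type} (I : Set (DBFact R D)) (U : Set D) : Prop :=
  I.Finite ∧ ∀ fc ∈ I, fc.valsIn U

section Parallel
variable {R D K : Type}

/-- `q` is parallel-sound on `I` under `ρ`. -/
def parSoundOn (q : Set (DBFact R D) → Set (DBFact R D)) (ρ : Policy R D K)
    (I : Set (DBFact R D)) : Prop :=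
  (⋃ κ : K, q (ρ.dist I κ)) ⊆ q I

/-- `q` is parallel-complete on `I` under `ρ`. -/
def parCompleteOn (q : Set (DBFact R D) → Set (DBFact R D)) (ρ : Policy R D K)
    (I : Set (DBFact R D)) : Prop :=
  q I ⊆ ⋃ κ : K, q (ρ.dist I κ)

/-- `q` is parallel-correct on `I` under `ρ`. -/
def parCorrectOn (q : Set (DBFact R D) → Set (DBFact R D)) (ρ : Policy R D K)
    (I : Set (DBFact R D)) : Prop :=
  q I = ⋃ κ : K, q (ρ.dist I κ)

/-- `q` is parallel-sound under `ρ`: sound on every instance with values from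
the universe of `ρ`. -/
def parSound (q : Set (DBFact R D) → Set (DBFact R D)) (ρ : Policy R D K) : Prop :=
  ∀ I : Set (DBFact R D), instOver I ρ.U → parSoundOn q ρ I

/-- `q` is parallel-complete under `ρ`. -/
def parComplete (q : Set (DBFact R D) → Set (DBFact R D)) (ρ : Policy R D K) : Prop :=
  ∀ I : Set (DBFact R D), instOver I ρ.U → parCompleteOn q ρ I

/-- `q` is parallel-correct under `ρ`. -/
def parCorrect (q : Set (DBFact R D) → Set (DBFact R D)) (ρ : Policy R D K) : Prop :=
  ∀ I : Set (DBFact R D), instOver I ρ.U → parCorrectOn q ρ I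

end Parallel

/-- The schema: a head relation `H` (nullary), a binary relation `Dom` and an
`n`-ary relation `R`. -/
inductive Rel11 | H | Dom | R
deriving DecidableEq

/-- Variables (as naturals): `w₀ = 0`, `w₁ = 1`, and `xᵢ = i + 1` for
`i = 1, …, n`. -/
abbrev Var11 := ℕ

/-- The query
`H() ← Dom(w₀,w₀), Dom(w₁,w₁), Dom(x₁,x₁), …, Dom(xₙ,xₙ), ¬Dom(w₀,w₁), ¬R(x₁,…,xₙ)`. -/
def ex11Q (n : ℕ) : CQ Rel11 Var11 :=
  ⟨⟨Rel11.H, []⟩,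
   ({⟨Rel11.Dom, [0, 0]⟩, ⟨Rel11.Dom, [1, 1]⟩} : Finset (Atom Rel11 Var11)) ∪
     (Finset.range n).image (fun i => ⟨Rel11.Dom, [i + 2, i + 2]⟩),
   ({⟨Rel11.Dom, [0, 1]⟩,
     ⟨Rel11.R, (List.range n).map (fun i => i + 2)⟩} : Finset (Atom Rel11 Var11)),
   ∅⟩

/-- The fact `R(0,…,0)` (`n` zeroes). -/
def ex11zeros (n : ℕ) : DBFact Rel11 ℕ := ⟨Rel11.R, List.replicate n 0⟩

/-- The policy over the two-node network (`true` = κ₁, `false` = κ₂) with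
universe `U = {0,1}`: κ₁ is responsible for all facts with values in `{0,1}`
except `R(0,…,0)`, and κ₂ only for `R(0,…,0)`. -/
def ex11ρ (n : ℕ) : Policy Rel11 ℕ Bool where
  U := {0, 1}
  rfacts := fun κ =>
    match κ with
    | true => {fc | fc.valsIn {0, 1} ∧ fc ≠ ex11zeros n}
    | false => {ex11zeros n}
  rfacts_vals := by
    intro κ fc hfc
    match κ with
    | true => exact hfc.1
    | false =>
      intro d hd
      simp only [Set.mem_singleton_iff] at hfc
      subst hfc
      simp only [ex11zeros] at hd
      have : d = 0 := List.eq_of_mem_replicate hd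
      subst this
      simp

/-- The instance `I = {Dom(0,0), Dom(1,1)} ∪ {R(a₁,…,aₙ) | (a₁,…,aₙ) ∈ {0,1}ⁿ}`. -/
def ex11I (n : ℕ) : Set (DBFact Rel11 ℕ) :=
  ({⟨Rel11.Dom, [0, 0]⟩, ⟨Rel11.Dom, [1, 1]⟩} : Set (DBFact Rel11 ℕ)) ∪
    {fc | ∃ l : List ℕ, l.length = n ∧ (∀ d ∈ l, d = 0 ∨ d = 1) ∧
          fc = ⟨Rel11.R, l⟩}

theorem mem_eval_ex11Q {n : ℕ} {J : Set (DBFact Rel11 ℕ)} {fc : DBFact Rel11 ℕ} :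
    fc ∈ (ex11Q n).eval J ↔ fc = ⟨Rel11.H, []⟩ ∧ ∃ (a b : ℕ) (l : List ℕ), l.length = n ∧
      ⟨Rel11.Dom, [a, a]⟩ ∈ J ∧ ⟨Rel11.Dom, [b, b]⟩ ∈ J ∧ (∀ d ∈ l, ⟨Rel11.Dom, [d, d]⟩ ∈ J) ∧
      ⟨Rel11.Dom, [a, b]⟩ ∉ J ∧ ⟨Rel11.R, l⟩ ∉ J := by
  constructor
  · rintro ⟨f, -, ⟨hpos, hneg⟩, rfl⟩
    have hp : ∀ a ∈ (ex11Q n).pos, Atom.app f a ∈ J := fun a ha => hpos ⟨a, ha, rfl⟩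
    have hq : ∀ a ∈ (ex11Q n).neg, Atom.app f a ∉ J := fun a ha h =>
      (Set.ext_iff.1 hneg _).1 ⟨⟨a, ha, rfl⟩, h⟩
    refine ⟨rfl, f 0, f 1, ((List.range n).map (fun i => i + 2)).map f, by simp,
      hp ⟨Rel11.Dom, [0, 0]⟩ (by simp [ex11Q]), hp ⟨Rel11.Dom, [1, 1]⟩ (by simp [ex11Q]), ?_,
      hq ⟨Rel11.Dom, [0, 1]⟩ (by simp [ex11Q]), hq ⟨Rel11.R, _⟩ (by simp [ex11Q])⟩
    intro d hd
    simp only [List.map_map, List.mem_map, List.mem_range, Function.comp_apply] at hd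
    obtain ⟨i, hi, rfl⟩ := hd
    exact hp ⟨Rel11.Dom, [i + 2, i + 2]⟩ (by simp [ex11Q, hi])
  · rintro ⟨rfl, a, b, l, rfl, ha, hb, hl, hab, hR⟩
    let f : ℕ → ℕ := fun i => (a :: b :: l).getD i 0
    have hf : ((List.range l.length).map (fun i => i + 2)).map f = l := by
      apply List.ext_getElem
      · simp
      · intro i h₁ h₂
        simp [f, h₂]
    have hpos : (ex11Q l.length).posFacts f ⊆ J := by
      rintro _ ⟨c, hc, rfl⟩
      simp only [ex11Q, Finset.coe_union, Set.mem_union, Finset.mem_coe, Finset.mem_insert,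
        Finset.mem_singleton, Finset.mem_image, Finset.mem_range] at hc
      rcases hc with (rfl | rfl) | ⟨i, hi, rfl⟩
      · exact ha
      · exact hb
      · simpa [Atom.app, f, hi] using hl l[i] (List.getElem_mem hi)
    have hneg : (ex11Q l.length).negFacts f ∩ J = ∅ := by
      rw [Set.eq_empty_iff_forall_notMem]
      rintro _ ⟨⟨c, hc, rfl⟩, hJ⟩
      simp only [ex11Q, Finset.mem_coe, Finset.mem_insert, Finset.mem_singleton] at hc
      rcases hc with rfl | rfl
      · exact hab hJ
      · rw [Atom.app, hf] at hJ
        exact hR hJ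
    refine ⟨f, ⟨?_, by simp [ex11Q]⟩, ⟨hpos, hneg⟩, rfl⟩
    rw [Set.eq_empty_iff_forall_notMem] at hneg ⊢
    exact fun x hx => hneg x ⟨hx.2, hpos hx.1⟩

theorem dom_mem_ex11I {n a b : ℕ} :
    (⟨Rel11.Dom, [a, b]⟩ : DBFact Rel11 ℕ) ∈ ex11I n ↔ a = b ∧ (a = 0 ∨ a = 1) := by
  simp only [ex11I, Set.mem_union, Set.mem_insert_iff, Set.mem_singleton_iff, Set.mem_ofPred_eq,
    DBFact.mk.injEq, List.cons.injEq, reduceCtorEq, false_and, and_false, exists_false, or_false,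
    and_true, true_and]
  omega

theorem rel_mem_ex11I {n : ℕ} {l : List ℕ} :
    (⟨Rel11.R, l⟩ : DBFact Rel11 ℕ) ∈ ex11I n ↔ l.length = n ∧ ∀ d ∈ l, d = 0 ∨ d = 1 := by
  simp [ex11I]

theorem dom_mem_dist_true {n a b : ℕ} {J : Set (DBFact Rel11 ℕ)}
    (hJ : ∀ fc ∈ J, fc.valsIn {0, 1}) :
    ⟨Rel11.Dom, [a, b]⟩ ∈ (ex11ρ n).dist J true ↔ ⟨Rel11.Dom, [a, b]⟩ ∈ J :=
  ⟨fun h => h.1, fun h => ⟨h, hJ _ h, by simp [ex11zeros]⟩⟩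

theorem ex11I_valsIn {n : ℕ} : ∀ fc ∈ ex11I n, fc.valsIn {0, 1} := by
  rintro fc ((rfl | rfl) | ⟨l, -, hl, rfl⟩) <;> intro d hd
  · simp_all
  · simp_all
  · exact hl d hd

theorem not_parSoundOn_ex11I (n : ℕ) :
    ¬ parSoundOn (fun I => (ex11Q n).eval I) (ex11ρ n) (ex11I n) := by
  intro h
  have key : (⟨Rel11.H, []⟩ : DBFact Rel11 ℕ) ∈ (ex11Q n).eval (ex11I n) := by
    refine h (Set.mem_iUnion.2 ⟨true, mem_eval_ex11Q.2 ⟨rfl, 0, 1, List.replicate n 0, by simp, ?_⟩⟩)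
    simp only [dom_mem_dist_true ex11I_valsIn, dom_mem_ex11I]
    exact ⟨by simp, by simp, fun d hd => by simp [List.eq_of_mem_replicate hd], by simp,
      fun hR => hR.2.2 rfl⟩
  obtain ⟨-, a, b, l, hl, -, -, hdom, -, hR⟩ := mem_eval_ex11Q.1 key
  exact hR (rel_mem_ex11I.2 ⟨hl, fun d hd => (dom_mem_ex11I.1 (hdom d hd)).2⟩)

theorem ex11I_subset_of_not_parSoundOn {n : ℕ} {J : Set (DBFact Rel11 ℕ)}
    (hJ : ∀ fc ∈ J, fc.valsIn {0, 1})
    (h : ¬ parSoundOn (fun I => (ex11Q n).eval I) (ex11ρ n) J) : ex11I n ⊆ J := by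
  obtain ⟨fc, hfc, hnot⟩ := Set.not_subset.1 h
  obtain ⟨κ, hκ⟩ := Set.mem_iUnion.1 hfc
  obtain ⟨rfl, a, b, l, -, ha, hb, -, hab, -⟩ := mem_eval_ex11Q.1 hκ
  cases κ with
  | false =>
    have : (⟨Rel11.Dom, [a, a]⟩ : DBFact Rel11 ℕ) = ex11zeros n := ha.2
    simp [ex11zeros] at this
  | true =>
    rw [dom_mem_dist_true hJ] at ha hb hab
    have ha' : a = 0 ∨ a = 1 := hJ _ ha a (by simp)
    have hb' : b = 0 ∨ b = 1 := hJ _ hb b (by simp)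
    have hne : a ≠ b := by
      rintro rfl
      exact hab ha
    have hdom : ∀ d, d = 0 ∨ d = 1 → (⟨Rel11.Dom, [d, d]⟩ : DBFact Rel11 ℕ) ∈ J := by
      intro d hd
      have : d = a ∨ d = b := by omega
      rcases this with rfl | rfl <;> assumption
    rintro fc ((rfl | rfl) | ⟨m, hm, hmd, rfl⟩)
    · exact hdom 0 (.inl rfl)
    · exact hdom 1 (.inr rfl)
    · by_contra hR
      exact hnot (mem_eval_ex11Q.2
        ⟨rfl, a, b, m, hm, ha, hb, fun d hd => hdom d (hmd d hd), hab, hR⟩)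

theorem ncard_ex11I (n : ℕ) : (ex11I n).ncard = 2 ^ n + 2 := by
  let g : (Fin n → Fin 2) → DBFact Rel11 ℕ := fun v => ⟨Rel11.R, List.ofFn fun i => (v i : ℕ)⟩
  have hg : Function.Injective g := by
    intro v w h
    have h' := List.ofFn_injective (DBFact.mk.inj h).2
    exact funext fun i => Fin.ext (congrFun h' i)
  have hrange : {fc : DBFact Rel11 ℕ | ∃ l : List ℕ, l.length = n ∧
      (∀ d ∈ l, d = 0 ∨ d = 1) ∧ fc = ⟨Rel11.R, l⟩} = Set.range g := by
    ext fc
    constructor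
    · rintro ⟨l, rfl, hl, rfl⟩
      refine ⟨fun i => ⟨l[i], ?_⟩, by simp [g]⟩
      have := hl l[i] (List.getElem_mem _)
      omega
    · rintro ⟨v, rfl⟩
      refine ⟨_, by simp, ?_, rfl⟩
      intro d hd
      obtain ⟨i, rfl⟩ := (List.mem_ofFn' _ _).1 hd
      have := (v i).isLt
      dsimp only
      omega
  rw [ex11I, hrange, Set.ncard_union_eq _ (Set.toFinite _) (Set.finite_range g),
    Set.ncard_pair (by simp), ← Set.image_univ, Set.ncard_image_of_injective _ hg, Set.ncard_univ]
  · simp [add_comm]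
  · rw [Set.disjoint_left]
    rintro _ (rfl | rfl) ⟨v, hv⟩ <;> simp [g] at hv

/-- (i) `Q` is not parallel-sound on `I` under `ρ`;
(ii) every instance `I*` of facts with values in `{0,1}` on which `Q` is not
parallel-sound under `ρ` satisfies `I ⊆ I*`; in particular the smallest
counterexample has `2ⁿ + 2` facts. -/
theorem ex11_exponential_counterexample (n : ℕ) (hn : 1 ≤ n) :
    (¬ parSoundOn (fun I => (ex11Q n).eval I) (ex11ρ n) (ex11I n)) ∧
    (∀ Istar : Set (DBFact Rel11 ℕ), Istar.Finite →
      (∀ fc ∈ Istar, fc.valsIn {0, 1}) →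
      ¬ parSoundOn (fun I => (ex11Q n).eval I) (ex11ρ n) Istar →
      ex11I n ⊆ Istar) ∧
    (ex11I n).ncard = 2 ^ n + 2 := by
  exact ⟨not_parSoundOn_ex11I n, fun _ _ hJ h => ex11I_subset_of_not_parSoundOn hJ h,
    ncard_ex11I n⟩
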